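/- Let {L₁,…,L₆} be a real Schläfli six, i.e., six pairwise skew lines in RP³ lying on a nonsingular cubic surface, and suppose that every 5-element subconfiguration {L₁,…,L₆}∖{Lᵢ} has signature 0 (the icosahedral case). Then the configuration {L₁,…,L₆} is not deformation equivalent to any join configuration J(σ), σ∈S₆, nor to any mirror image of a join configuration. -/

import Mathlib

open Submodule

abbrev V4 : Type := Fin 4 → ℝ

abbrev PLine : Type := Submodule ℝ V4

def IsLine (P : PLine) : Prop := Module.finrank ℝ P = 2

def Skew (P Q : PLine) : Prop := IsLine P ∧ IsLine Q ∧ P ⊓ Q = ⊥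

def PairwiseSkew {n : ℕ} (L : Fin n → PLine) : Prop :=
  ∀ i j : Fin n, i ≠ j → Skew (L i) (L j)

noncomputable def det2 (a b c d : V4) : ℝ := Matrix.det (Matrix.of ![a, b, c, d])

open Classical in
noncomputable def lk (P Q R : PLine) : ℝ :=
  if h : ∃ v : Fin 6 → V4,
      P = span ℝ {v 0, v 1} ∧ Q = span ℝ {v 2, v 3} ∧ R = span ℝ {v 4, v 5} then
    Real.sign (det2 (h.choose 0) (h.choose 1) (h.choose 2) (h.choose 3) *
      det2 (h.choose 0) (h.choose 1) (h.choose 4) (h.choose 5) *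
      det2 (h.choose 2) (h.choose 3) (h.choose 4) (h.choose 5))
  else 0

noncomputable def sgnOf {n : ℕ} (L : Fin n → PLine) : ℝ :=
  ∑ i : Fin n, ∑ j : Fin n, ∑ k : Fin n,
    if i < j ∧ j < k then lk (L i) (L j) (L k) else 0

def ContinuousLineFamily (L : ℝ → PLine) : Prop :=
  ∃ v w : ℝ → V4, ContinuousOn v (Set.Icc 0 1) ∧ ContinuousOn w (Set.Icc 0 1) ∧
    ∀ t ∈ Set.Icc (0:ℝ) 1, L t = span ℝ {v t, w t}

def Deformation {n : ℕ} (L L' : Fin n → PLine) : Prop :=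
  ∃ F : ℝ → Fin n → PLine,
    (∀ i, ContinuousLineFamily (fun t => F t i)) ∧
    (∀ t ∈ Set.Icc (0:ℝ) 1, PairwiseSkew (F t)) ∧
    F 0 = L ∧ F 1 = L'

def DeformEquiv {n : ℕ} (L L' : Fin n → PLine) : Prop :=
  ∃ π π' : Equiv.Perm (Fin n), Deformation (L ∘ π) (L' ∘ π')

def IsMirror {n : ℕ} (L L' : Fin n → PLine) : Prop :=
  ∃ A : V4 →ₗ[ℝ] V4, LinearMap.det A < 0 ∧ ∀ i, L' i = (L i).map A

def CoarseDeformEquiv {n : ℕ} (L L' : Fin n → PLine) : Prop :=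
  DeformEquiv L L' ∨ ∃ M : Fin n → PLine, IsMirror L' M ∧ DeformEquiv L M

noncomputable def joinConfig {n : ℕ} (σ : Equiv.Perm (Fin n)) : Fin n → PLine :=
  fun i => span ℝ {![1, (i.val : ℝ) + 1, 0, 0], ![0, 0, ((σ i).val : ℝ) + 1, 1]}

def IsSchlafliSix (L : Fin 6 → PLine) : Prop :=
  PairwiseSkew L ∧
  ∃ F : MvPolynomial (Fin 4) ℝ,
    F ≠ 0 ∧ F.IsHomogeneous 3 ∧
    (∀ i : Fin 6, ∀ x ∈ L i, MvPolynomial.eval x F = 0) ∧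
    (∀ z : Fin 4 → ℂ, z ≠ 0 →
      MvPolynomial.eval z (MvPolynomial.map (algebraMap ℝ ℂ) F) = 0 →
      ∃ j : Fin 4, MvPolynomial.eval z (MvPolynomial.map (algebraMap ℝ ℂ) (MvPolynomial.pderiv j F)) ≠ 0)

def Reducible {n : ℕ} (L : Fin n → PLine) : Prop :=
  ∃ i j : Fin n, i ≠ j ∧ ∃ F : ℝ → Fin n → PLine,
    (∀ k, ContinuousLineFamily (fun t => F t k)) ∧
    F 0 = L ∧
    (∀ t ∈ Set.Ico (0:ℝ) 1, PairwiseSkew (F t)) ∧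
    F 1 i = F 1 j ∧
    (∀ k l : Fin n, k ≠ l → ¬(k = i ∧ l = j) → ¬(k = j ∧ l = i) → Skew (F 1 k) (F 1 l))


theorem det2_swap (a b c d : V4) : det2 c d a b = det2 a b c d := by
  simp [det2, Matrix.det_succ_row_zero, Fin.sum_univ_succ, Fin.succAbove]
  ring

theorem det2_combination (a b x y : V4) (p q r s : ℝ) :
    det2 (p • a + q • b) (r • a + s • b) x y = (p * s - q * r) * det2 a b x y := by
  simp [det2, Matrix.det_succ_row_zero, Fin.sum_univ_succ, Fin.succAbove]
  ring

theorem det2_map (A : V4 →ₗ[ℝ] V4) (a b c d : V4) :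
    det2 (A a) (A b) (A c) (A d) = LinearMap.det A * det2 a b c d := by
  have h : (Matrix.of ![A a, A b, A c, A d] : Matrix (Fin 4) (Fin 4) ℝ) =
      Matrix.of ![a, b, c, d] * (LinearMap.toMatrix' A).transpose := by
    ext i j
    have hA (v : V4) : A v j = ∑ k, v k * LinearMap.toMatrix' A j k := by
      conv_lhs => rw [← LinearMap.toMatrix'_mulVec A v]
      simp [Matrix.mulVec, dotProduct, mul_comm]
    fin_cases i <;> simp only [Matrix.mul_apply, Matrix.transpose_apply] <;> exact hA _
  rw [det2, h, Matrix.det_mul, Matrix.det_transpose, LinearMap.det_toMatrix', mul_comm, det2]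

theorem exists_det2_eq_mul_of_span_eq {a b a' b' : V4}
    (h : span ℝ {a, b} = span ℝ ({a', b'} : Set V4)) :
    ∃ d : ℝ, ∀ x y, det2 a' b' x y = d * det2 a b x y := by
  have ha : a' ∈ span ℝ ({a, b} : Set V4) := h ▸ subset_span (by simp)
  have hb : b' ∈ span ℝ ({a, b} : Set V4) := h ▸ subset_span (by simp)
  obtain ⟨p, q, rfl⟩ := mem_span_pair.1 ha
  obtain ⟨r, s, rfl⟩ := mem_span_pair.1 hb
  exact ⟨p * s - q * r, fun x y => det2_combination a b x y p q r s⟩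

theorem IsLine.exists_span_pair {P : PLine} (h : IsLine P) : ∃ a b : V4, P = span ℝ {a, b} := by
  let B := Module.finBasisOfFinrankEq ℝ P h
  refine ⟨B 0, B 1, ?_⟩
  have hB := congrArg (Submodule.map P.subtype) B.span_eq
  rw [Submodule.map_span, Submodule.map_top, Submodule.range_subtype] at hB
  refine hB.symm.trans (congrArg (span ℝ) ?_)
  ext x
  simp [Fin.exists_fin_two, eq_comm]

theorem IsLine.eq_zero_of_combination {a b : V4} (h : IsLine (span ℝ {a, b})) {p q : ℝ}
    (h0 : p • a + q • b = 0) : p = 0 ∧ q = 0 := by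
  have hli : LinearIndependent ℝ ![a, b] := by
    rw [linearIndependent_iff_card_eq_finrank_span, Set.finrank, Matrix.range_cons_cons_empty]
    exact h.symm
  exact LinearIndependent.pair_iff.1 hli p q h0

theorem Skew.det2_ne_zero {a b c d : V4} (h : Skew (span ℝ {a, b}) (span ℝ {c, d})) :
    det2 a b c d ≠ 0 := by
  obtain ⟨hP, hQ, hPQ⟩ := h
  intro h0
  obtain ⟨v, hv, hv0⟩ := Matrix.exists_vecMul_eq_zero_iff.2 h0
  have hsum : v 0 • a + v 1 • b + (v 2 • c + v 3 • d) = 0 := by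
    rw [← hv0]
    ext j
    simp [Matrix.vecMul, dotProduct, Fin.sum_univ_succ]
    ring
  have hmem : v 0 • a + v 1 • b ∈ span ℝ {a, b} ⊓ span ℝ {c, d} := by
    refine ⟨mem_span_pair.2 ⟨_, _, rfl⟩, ?_⟩
    rw [eq_neg_of_add_eq_zero_left hsum]
    exact neg_mem (mem_span_pair.2 ⟨_, _, rfl⟩)
  rw [hPQ, mem_bot] at hmem
  rw [hmem, zero_add] at hsum
  obtain ⟨h0, h1⟩ := hP.eq_zero_of_combination hmem
  obtain ⟨h2, h3⟩ := hQ.eq_zero_of_combination hsum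
  refine hv (funext fun i => ?_)
  fin_cases i <;> assumption

theorem Real.sign_mul_of_pos {r : ℝ} (hr : 0 < r) (x : ℝ) : Real.sign (r * x) = Real.sign x := by
  rcases lt_trichotomy x 0 with h | rfl | h
  · rw [Real.sign_of_neg h, Real.sign_of_neg (mul_neg_of_pos_of_neg hr h)]
  · simp
  · rw [Real.sign_of_pos h, Real.sign_of_pos (mul_pos hr h)]

theorem lk_eq_sign {P Q R : PLine} (hPQ : Skew P Q) (hPR : Skew P R)
    {a b c d e f : V4} (hP : P = span ℝ {a, b}) (hQ : Q = span ℝ {c, d})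
    (hR : R = span ℝ {e, f}) :
    lk P Q R = Real.sign (det2 a b c d * det2 a b e f * det2 c d e f) := by
  have h : ∃ v : Fin 6 → V4,
      P = span ℝ {v 0, v 1} ∧ Q = span ℝ {v 2, v 3} ∧ R = span ℝ {v 4, v 5} :=
    ⟨![a, b, c, d, e, f], hP, hQ, hR⟩
  rw [lk, dif_pos h]
  obtain ⟨hP', hQ', hR'⟩ := h.choose_spec
  generalize h.choose = v at hP' hQ' hR' ⊢
  obtain ⟨p, hp⟩ := exists_det2_eq_mul_of_span_eq (hP.symm.trans hP')
  obtain ⟨q, hq⟩ := exists_det2_eq_mul_of_span_eq (hQ.symm.trans hQ')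
  obtain ⟨r, hr⟩ := exists_det2_eq_mul_of_span_eq (hR.symm.trans hR')
  have h12 : det2 (v 0) (v 1) (v 2) (v 3) = p * q * det2 a b c d := by
    rw [hp, ← det2_swap, hq, ← det2_swap]; ring
  have h13 : det2 (v 0) (v 1) (v 4) (v 5) = p * r * det2 a b e f := by
    rw [hp, ← det2_swap, hr, ← det2_swap]; ring
  have h23 : det2 (v 2) (v 3) (v 4) (v 5) = q * r * det2 c d e f := by
    rw [hq, ← det2_swap, hr, ← det2_swap]; ring
  rw [hP', hQ'] at hPQ
  rw [hP', hR'] at hPR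
  have h12' := hPQ.det2_ne_zero
  have h13' := hPR.det2_ne_zero
  rw [h12] at h12'
  rw [h13] at h13'
  have hpqr : p * q * r ≠ 0 := by
    refine mul_ne_zero (left_ne_zero_of_mul h12') ?_
    exact right_ne_zero_of_mul (left_ne_zero_of_mul h13')
  rw [h12, h13, h23, ← Real.sign_mul_of_pos (sq_pos_of_ne_zero hpqr)
    (det2 a b c d * det2 a b e f * det2 c d e f)]
  congr 1
  ring

theorem lk_swap_left {P Q R : PLine} (hPQ : Skew P Q) (hPR : Skew P R) (hQR : Skew Q R) :
    lk Q P R = lk P Q R := by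
  obtain ⟨a, b, hP⟩ := hPQ.1.exists_span_pair
  obtain ⟨c, d, hQ⟩ := hPQ.2.1.exists_span_pair
  obtain ⟨e, f, hR⟩ := hPR.2.1.exists_span_pair
  have hQP : Skew Q P := ⟨hPQ.2.1, hPQ.1, inf_comm P Q ▸ hPQ.2.2⟩
  rw [lk_eq_sign hPQ hPR hP hQ hR, lk_eq_sign hQP hQR hQ hP hR, det2_swap a b c d]
  congr 1
  ring

theorem lk_swap_right {P Q R : PLine} (hPQ : Skew P Q) (hPR : Skew P R) :
    lk P R Q = lk P Q R := by
  obtain ⟨a, b, hP⟩ := hPQ.1.exists_span_pair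
  obtain ⟨c, d, hQ⟩ := hPQ.2.1.exists_span_pair
  obtain ⟨e, f, hR⟩ := hPR.2.1.exists_span_pair
  rw [lk_eq_sign hPQ hPR hP hQ hR, lk_eq_sign hPR hPQ hP hR hQ, det2_swap c d e f]
  congr 1
  ring

theorem continuousOn_det2 {s : Set ℝ} {a b c d : ℝ → V4} (ha : ContinuousOn a s)
    (hb : ContinuousOn b s) (hc : ContinuousOn c s) (hd : ContinuousOn d s) :
    ContinuousOn (fun t => det2 (a t) (b t) (c t) (d t)) s := by
  have h : Continuous fun x : V4 × V4 × V4 × V4 => det2 x.1 x.2.1 x.2.2.1 x.2.2.2 := by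
    refine Continuous.matrix_det (continuous_matrix fun i j => ?_)
    fin_cases i <;> simp <;> fun_prop
  exact h.comp_continuousOn (f := fun t => (a t, b t, c t, d t)) (ha.prodMk (hb.prodMk (hc.prodMk hd)))

theorem sign_eq_of_continuousOn_Icc {f : ℝ → ℝ} (hf : ContinuousOn f (Set.Icc 0 1))
    (h0 : ∀ t ∈ Set.Icc (0 : ℝ) 1, f t ≠ 0) : Real.sign (f 0) = Real.sign (f 1) := by
  rcases lt_or_gt_of_ne (h0 0 (by simp)) with h | h <;>
    rcases lt_or_gt_of_ne (h0 1 (by simp)) with h' | h'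
  · rw [Real.sign_of_neg h, Real.sign_of_neg h']
  · obtain ⟨t, ht, hft⟩ := intermediate_value_Icc zero_le_one hf ⟨h.le, h'.le⟩
    exact absurd hft (h0 t ht)
  · obtain ⟨t, ht, hft⟩ := intermediate_value_Icc' zero_le_one hf ⟨h'.le, h.le⟩
    exact absurd hft (h0 t ht)
  · rw [Real.sign_of_pos h, Real.sign_of_pos h']

theorem Deformation.pairwiseSkew_right {n : ℕ} {L L' : Fin n → PLine} (h : Deformation L L') :
    PairwiseSkew L' := by
  obtain ⟨F, -, hskew, -, rfl⟩ := h
  exact hskew 1 (by simp)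

theorem Deformation.lk_eq {n : ℕ} {L L' : Fin n → PLine} (h : Deformation L L') {i j k : Fin n}
    (hij : i ≠ j) (hik : i ≠ k) (hjk : j ≠ k) :
    lk (L i) (L j) (L k) = lk (L' i) (L' j) (L' k) := by
  obtain ⟨F, hF, hskew, rfl, rfl⟩ := h
  obtain ⟨a, b, ha, hb, hab⟩ := hF i
  obtain ⟨c, d, hc, hd, hcd⟩ := hF j
  obtain ⟨e, f, he, hf, hef⟩ := hF k
  dsimp only at hab hcd hef
  have hlk {t : ℝ} (ht : t ∈ Set.Icc (0 : ℝ) 1) :=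
    lk_eq_sign (hskew t ht i j hij) (hskew t ht i k hik)
      (hab t ht) (hcd t ht) (hef t ht)
  rw [hlk (by simp), hlk (by simp)]
  refine sign_eq_of_continuousOn_Icc (((continuousOn_det2 ha hb hc hd).mul
    (continuousOn_det2 ha hb he hf)).mul (continuousOn_det2 hc hd he hf)) fun t ht => ?_
  have h1 := hskew t ht i j hij
  have h2 := hskew t ht i k hik
  have h3 := hskew t ht j k hjk
  rw [hab t ht, hcd t ht] at h1
  rw [hab t ht, hef t ht] at h2
  rw [hcd t ht, hef t ht] at h3
  exact mul_ne_zero (mul_ne_zero h1.det2_ne_zero h2.det2_ne_zero) h3.det2_ne_zero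

theorem sum_distinct_eq_six_mul {n : ℕ} (f : Fin n → Fin n → Fin n → ℝ)
    (hl : ∀ i j k, i ≠ j → i ≠ k → j ≠ k → f j i k = f i j k)
    (hr : ∀ i j k, i ≠ j → i ≠ k → j ≠ k → f i k j = f i j k) :
    (∑ i, ∑ j, ∑ k, if i ≠ j ∧ i ≠ k ∧ j ≠ k then f i j k else 0) =
      6 * ∑ i, ∑ j, ∑ k, if i < j ∧ j < k then f i j k else 0 := by
  let g : Fin n → Fin n → Fin n → ℝ := fun i j k => if i < j ∧ j < k then f i j k else 0
  have hg (i j k : Fin n) : (if i ≠ j ∧ i ≠ k ∧ j ≠ k then f i j k else 0) =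
      g i j k + g i k j + g j i k + g j k i + g k i j + g k j i := by
    dsimp only [g]
    by_cases h : i ≠ j ∧ i ≠ k ∧ j ≠ k
    · obtain ⟨hij, hik, hjk⟩ := h
      have e1 := hr i j k hij hik hjk
      have e2 := hl i j k hij hik hjk
      have e3 := hr j i k hij.symm hjk hik
      have e4 := hl i k j hik hij hjk.symm
      have e5 := hr k i j hik.symm hjk.symm hij
      rcases lt_or_gt_of_ne hij with h1 | h1 <;> rcases lt_or_gt_of_ne hik with h2 | h2 <;>
        rcases lt_or_gt_of_ne hjk with h3 | h3 <;>
        simp [hij, hik, hjk, h1, h2, h3, h1.not_gt, h2.not_gt, h3.not_gt] <;>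
        first | linarith | (exfalso; order)
    · rw [if_neg h]
      repeat rw [if_neg (by rintro ⟨h1, h2⟩; exact h (by refine ⟨?_, ?_, ?_⟩ <;> order))]
      simp
  have c1 (u : Fin n → Fin n → Fin n → ℝ) :
      ∑ i, ∑ j, ∑ k, u i k j = ∑ i, ∑ j, ∑ k, u i j k :=
    Finset.sum_congr rfl fun i _ => Finset.sum_comm
  have c2 (u : Fin n → Fin n → Fin n → ℝ) :
      ∑ i, ∑ j, ∑ k, u j i k = ∑ i, ∑ j, ∑ k, u i j k := Finset.sum_comm
  simp only [hg, Finset.sum_add_distrib]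
  rw [c1 g, c2 g, c2 (fun i j k => g i k j), c1 g, c1 (fun i j k => g j i k), c2 g,
    c1 (fun i j k => g j k i), c2 (fun i j k => g i k j), c1 g]
  ring

/-- The sum of the linking indices of ordered triples of distinct lines avoiding the `i`-th one. -/
noncomputable def linkSumAvoiding {n : ℕ} (L : Fin n → PLine) (i : Fin n) : ℝ :=
  ∑ a, ∑ b, ∑ c, if (a ≠ i ∧ b ≠ i ∧ c ≠ i) ∧ a ≠ b ∧ a ≠ c ∧ b ≠ c
    then lk (L a) (L b) (L c) else 0

theorem linkSumAvoiding_eq {n : ℕ} {L : Fin (n + 1) → PLine} (hL : PairwiseSkew L)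
    (i : Fin (n + 1)) : linkSumAvoiding L i = 6 * sgnOf (L ∘ i.succAbove) := by
  rw [sgnOf, ← sum_distinct_eq_six_mul]
  · simp [linkSumAvoiding, Fin.sum_univ_succAbove _ i]
  · intro a b c hab hac hbc
    apply lk_swap_left <;> apply hL <;> simpa
  · intro a b c hab hac hbc
    apply lk_swap_right <;> apply hL <;> simpa

theorem linkSumAvoiding_comp {n : ℕ} (L : Fin n → PLine) (π : Equiv.Perm (Fin n)) (i : Fin n) :
    linkSumAvoiding (L ∘ π) i = linkSumAvoiding L (π i) := by
  unfold linkSumAvoiding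
  refine Fintype.sum_equiv π _ _ fun a => Fintype.sum_equiv π _ _ fun b =>
    Fintype.sum_equiv π _ _ fun c => ?_
  simp

theorem Deformation.linkSumAvoiding_eq {n : ℕ} {L L' : Fin n → PLine} (h : Deformation L L')
    (i : Fin n) : linkSumAvoiding L i = linkSumAvoiding L' i := by
  unfold linkSumAvoiding
  refine Finset.sum_congr rfl fun a _ => Finset.sum_congr rfl fun b _ =>
    Finset.sum_congr rfl fun c _ => ?_
  split_ifs with hc
  · exact h.lk_eq hc.2.1 hc.2.2.1 hc.2.2.2
  · rfl

/-- The condition of vanishing signatures of the subconfigurations omitting one line is invariant under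
deformation equivalence. -/
theorem DeformEquiv.sgnOf_succAbove_eq_zero {n : ℕ} {L M : Fin (n + 1) → PLine}
    (hL : PairwiseSkew L) (hM : PairwiseSkew M) (h : DeformEquiv L M)
    (h0 : ∀ i : Fin (n + 1), sgnOf (L ∘ i.succAbove) = 0) (i : Fin (n + 1)) :
    sgnOf (M ∘ i.succAbove) = 0 := by
  obtain ⟨π, π', hdef⟩ := h
  have key := hdef.linkSumAvoiding_eq (π'.symm i)
  rw [linkSumAvoiding_comp, linkSumAvoiding_comp, Equiv.apply_symm_apply,
    linkSumAvoiding_eq hL, linkSumAvoiding_eq hM, h0] at key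
  linarith

/-- The sign of the order of a pair: `1` if it is increasing, `-1` otherwise. -/
def orderSign {n : ℕ} (a b : Fin n) : ℤ := if a < b then 1 else -1

/-- The product of the order signs of the pairs from a triple. -/
def tripleSign {n : ℕ} (a b c : Fin n) : ℤ :=
  bif decide (a < b) ^^ (decide (a < c) ^^ decide (b < c)) then 1 else -1

theorem tripleSign_eq {n : ℕ} (a b c : Fin n) :
    tripleSign a b c = orderSign a b * orderSign a c * orderSign b c := by
  unfold tripleSign orderSign
  split_ifs with h1 h2 h3 h3 h2 h3 h3 <;> simp [*]

/-- The sum of the signs of the triples from a sequence of length five. -/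
def fiveSum {n : ℕ} (a b c d e : Fin n) : ℤ :=
  tripleSign a b c + tripleSign a b d + tripleSign a b e + tripleSign a c d + tripleSign a c e +
  tripleSign a d e + tripleSign b c d + tripleSign b c e + tripleSign b d e + tripleSign c d e

theorem fiveSum_ne_zero_of_forall_ne : ∀ a b : Fin 6, a ≠ b → ∀ c, a ≠ c ∧ b ≠ c →
    ∀ d, a ≠ d ∧ b ≠ d ∧ c ≠ d → ∀ e, (a ≠ e ∧ b ≠ e ∧ c ≠ e ∧ d ≠ e) ∧ fiveSum a b c d e = 0 →
    ∀ f, a ≠ f ∧ b ≠ f ∧ c ≠ f ∧ d ≠ f ∧ e ≠ f →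
    fiveSum b c d e f = 0 → fiveSum a c d e f = 0 → fiveSum a b d e f = 0 →
    fiveSum a b c e f = 0 → fiveSum a b c d f ≠ 0 := by
  decide +kernel

theorem exists_fiveSum_ne_zero (σ : Equiv.Perm (Fin 6)) : ∃ i : Fin 6,
    fiveSum (σ (i.succAbove 0)) (σ (i.succAbove 1)) (σ (i.succAbove 2)) (σ (i.succAbove 3))
      (σ (i.succAbove 4)) ≠ 0 := by
  by_contra! h
  refine fiveSum_ne_zero_of_forall_ne (σ 0) (σ 1) ?_ (σ 2) ?_ (σ 3) ?_ (σ 4) ⟨?_, h 5⟩ (σ 5) ?_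
    (h 0) (h 1) (h 2) (h 3) (h 4) <;> simp

theorem fiveSum_cast {n : ℕ} (y : Fin 5 → Fin n) :
    (fiveSum (y 0) (y 1) (y 2) (y 3) (y 4) : ℝ) = ∑ i : Fin 5, ∑ j : Fin 5, ∑ k : Fin 5,
      if i < j ∧ j < k then (tripleSign (y i) (y j) (y k) : ℝ) else 0 := by
  simp [fiveSum, Fin.sum_univ_five]
  ring

theorem det2_joinConfig (x y x' y' : ℝ) :
    det2 ![1, x, 0, 0] ![0, 0, y, 1] ![1, x', 0, 0] ![0, 0, y', 1] = (x' - x) * (y' - y) := by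
  simp [det2, Matrix.det_succ_row_zero, Fin.sum_univ_succ, Fin.succAbove]
  ring

theorem exists_pos_mul_orderSign {n : ℕ} (σ : Equiv.Perm (Fin n)) {a b : Fin n} (h : a < b) :
    ∃ r : ℝ, 0 < r ∧ (((b : ℝ) + 1) - ((a : ℝ) + 1)) * ((((σ b : Fin n) : ℝ) + 1) -
      (((σ a : Fin n) : ℝ) + 1)) = r * orderSign (σ a) (σ b) := by
  have hab : (a : ℝ) < b := by exact_mod_cast h
  rcases lt_or_gt_of_ne (σ.injective.ne h.ne) with hσ | hσ
  · have hσ' : ((σ a : Fin n) : ℝ) < (σ b : Fin n) := by exact_mod_cast hσ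
    refine ⟨(b - a) * ((σ b : Fin n) - (σ a : Fin n)),
      mul_pos (sub_pos.2 hab) (sub_pos.2 hσ'), ?_⟩
    simp [orderSign, hσ]
  · have hσ' : ((σ b : Fin n) : ℝ) < (σ a : Fin n) := by exact_mod_cast hσ
    refine ⟨(b - a) * ((σ a : Fin n) - (σ b : Fin n)),
      mul_pos (sub_pos.2 hab) (sub_pos.2 hσ'), ?_⟩
    simp [orderSign, hσ.not_gt]
    ring

theorem lk_map_joinConfig {n : ℕ} (σ : Equiv.Perm (Fin n)) (A : V4 →ₗ[ℝ] V4)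
    (hskew : PairwiseSkew fun i => (joinConfig σ i).map A) {a b c : Fin n} (hab : a < b)
    (hbc : b < c) :
    lk ((joinConfig σ a).map A) ((joinConfig σ b).map A) ((joinConfig σ c).map A) =
      Real.sign (LinearMap.det A) * tripleSign (σ a) (σ b) (σ c) := by
  have hac := hab.trans hbc
  have hspan (i : Fin n) : (joinConfig σ i).map A =
      span ℝ {A ![1, (i.val : ℝ) + 1, 0, 0], A ![0, 0, ((σ i).val : ℝ) + 1, 1]} := by
    rw [joinConfig, Submodule.map_span, Set.image_pair]
  have hne : LinearMap.det A ≠ 0 := by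
    have h := hskew a b hab.ne
    simp only [hspan] at h
    have h' := h.det2_ne_zero
    rw [det2_map] at h'
    exact left_ne_zero_of_mul h'
  rw [lk_eq_sign (hskew a b hab.ne) (hskew a c hac.ne)
    (hspan a) (hspan b) (hspan c)]
  simp only [det2_map, det2_joinConfig]
  obtain ⟨p, hp, h1⟩ := exists_pos_mul_orderSign σ hab
  obtain ⟨q, hq, h2⟩ := exists_pos_mul_orderSign σ hac
  obtain ⟨r, hr, h3⟩ := exists_pos_mul_orderSign σ hbc
  rw [h1, h2, h3, tripleSign_eq]
  have hpos : 0 < LinearMap.det A ^ 2 * (p * q * r) := by positivity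
  trans Real.sign ((LinearMap.det A ^ 2 * (p * q * r)) * (LinearMap.det A *
    (orderSign (σ a) (σ b) * orderSign (σ a) (σ c) * orderSign (σ b) (σ c) : ℝ)))
  · congr 1
    ring
  · rw [Real.sign_mul_of_pos hpos]
    have h (x y : Fin n) : (orderSign x y : ℝ) = 1 ∨ (orderSign x y : ℝ) = -1 := by
      unfold orderSign
      split_ifs <;> simp
    rcases h (σ a) (σ b) with h1 | h1 <;> rcases h (σ a) (σ c) with h2 | h2 <;>
      rcases h (σ b) (σ c) with h3 | h3 <;>
      simp [h1, h2, h3, Real.sign_neg]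

theorem sgnOf_map_joinConfig (σ : Equiv.Perm (Fin 6)) (A : V4 →ₗ[ℝ] V4)
    (hskew : PairwiseSkew fun i => (joinConfig σ i).map A) (i : Fin 6) :
    sgnOf ((fun i => (joinConfig σ i).map A) ∘ i.succAbove) =
      Real.sign (LinearMap.det A) *
        fiveSum (σ (i.succAbove 0)) (σ (i.succAbove 1)) (σ (i.succAbove 2))
          (σ (i.succAbove 3)) (σ (i.succAbove 4)) := by
  rw [fiveSum_cast fun a => σ (i.succAbove a), sgnOf]
  simp only [Finset.mul_sum]
  refine Finset.sum_congr rfl fun a _ => Finset.sum_congr rfl fun b _ =>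
    Finset.sum_congr rfl fun c _ => ?_
  split_ifs with h
  · exact lk_map_joinConfig σ A hskew (Fin.succAbove_lt_succAbove_iff.2 h.1)
      (Fin.succAbove_lt_succAbove_iff.2 h.2)
  · simp

theorem DeformEquiv.pairwiseSkew_right {n : ℕ} {L M : Fin n → PLine} (h : DeformEquiv L M) :
    PairwiseSkew M := by
  obtain ⟨π, π', hdef⟩ := h
  intro i j hij
  simpa using hdef.pairwiseSkew_right (π'.symm i) (π'.symm j) (π'.symm.injective.ne hij)

theorem not_deformEquiv_map_joinConfig {L : Fin 6 → PLine} (hL : PairwiseSkew L)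
    (hsig : ∀ i : Fin 6, sgnOf (L ∘ i.succAbove) = 0) (σ : Equiv.Perm (Fin 6))
    {A : V4 →ₗ[ℝ] V4} (hA : LinearMap.det A ≠ 0) :
    ¬ DeformEquiv L fun i => (joinConfig σ i).map A := by
  intro h
  obtain ⟨i, hi⟩ := exists_fiveSum_ne_zero σ
  have hskew := h.pairwiseSkew_right
  have h0 := h.sgnOf_succAbove_eq_zero hL hskew hsig i
  rw [sgnOf_map_joinConfig σ A hskew i, mul_eq_zero, Real.sign_eq_zero_iff] at h0
  exact h0.elim hA fun h => hi (by exact_mod_cast h)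

theorem schlafli_icosahedral_not_join (L : Fin 6 → PLine) (hL : IsSchlafliSix L)
    (hsig : ∀ i : Fin 6, sgnOf (L ∘ i.succAbove) = 0) :
    (∀ σ : Equiv.Perm (Fin 6), ¬ DeformEquiv L (joinConfig σ)) ∧
    (∀ σ : Equiv.Perm (Fin 6), ∀ M : Fin 6 → PLine,
      IsMirror (joinConfig σ) M → ¬ DeformEquiv L M) := by
  refine ⟨fun σ => ?_, fun σ M hM => ?_⟩
  · simpa using not_deformEquiv_map_joinConfig hL.1 hsig σ (A := LinearMap.id) (by simp)
  · obtain ⟨A, hA, hMA⟩ := hM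
    obtain rfl : M = fun i => (joinConfig σ i).map A := funext hMA
    exact not_deformEquiv_map_joinConfig hL.1 hsig σ hA.ne
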